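/- arXiv:2510.23567 — 2 statements merged into one kernel-verified Lean document; each statement's English description precedes it below -/
import Mathlib

section
/- Let Γ = (V, E, s, t) be a connected quiver with non-empty boundary, let W be a finite-dimensional real normed vector space, and let B = (B_e)_{e∈E} be a tuple of continuous maps B_e : [0,1] → End(W). Then the set of tuples x = (x_e)_{e∈E} of C¹ functions x_e : [0,1] → W satisfying ẋ_e(t) + B_e(t) x_e(t) = 0 for all t ∈ [0,1] and all e ∈ E, and ∑_{e∈s⁻¹(v)} x_e(0) = ∑_{e∈t⁻¹(v)} x_e(1) for every interior vertex v ∈ Γ_int, is a real vector space of dimension (|E| − |Γ_int|) · dim W. -/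
open Set Finset

noncomputable section

/-- The unit interval `[0,1]` as a subset of `ℝ`. -/
abbrev I01 : Set ℝ := Set.Icc 0 1

lemma zero_mem_I01 : (0:ℝ) ∈ I01 := Set.mem_Icc.mpr ⟨le_refl 0, zero_le_one⟩
lemma one_mem_I01 : (1:ℝ) ∈ I01 := Set.mem_Icc.mpr ⟨zero_le_one, le_refl 1⟩

/-- The derivative of a function within the interval `[0,1]`. -/
def dd {W : Type*} [NormedAddCommGroup W] [NormedSpace ℝ W]
    (f : ℝ → W) (τ : ℝ) : W :=
  derivWithin f I01 τ

section QuiverDefs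

variable {V E : Type*} [Fintype V] [Fintype E] [DecidableEq V]

/-- The degree of a vertex of the quiver `(V, E, s, t)`. -/
def qdeg (s t : E → V) (v : V) : ℕ :=
  (Finset.univ.filter fun e => s e = v).card + (Finset.univ.filter fun e => t e = v).card

/-- A boundary vertex is a vertex of degree 1. -/
def IsBoundaryVtx (s t : E → V) (v : V) : Prop := qdeg s t v = 1

/-- An interior vertex is a vertex which is not a boundary vertex. -/
def IsInteriorVtx (s t : E → V) (v : V) : Prop := ¬ IsBoundaryVtx s t v

instance (s t : E → V) (v : V) : Decidable (IsBoundaryVtx s t v) := by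
  unfold IsBoundaryVtx; infer_instance

instance (s t : E → V) (v : V) : Decidable (IsInteriorVtx s t v) := by
  unfold IsInteriorVtx; infer_instance

/-- The quiver has no isolated vertices. -/
def NoIsolated (s t : E → V) : Prop := ∀ v : V, ∃ e : E, s e = v ∨ t e = v

/-- Connectedness of the underlying undirected graph of the quiver. -/
def QConnected (s t : E → V) : Prop :=
  ∀ v w : V, Relation.ReflTransGen
    (fun a b => ∃ e : E, (s e = a ∧ t e = b) ∨ (s e = b ∧ t e = a)) v w

end QuiverDefs

section LinearODE

variable {W : Type*} [NormedAddCommGroup W] [NormedSpace ℝ W]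

/-- The map which is the identity on the closed ball of radius `R` and pushes every other point
radially to the sphere of radius `R`. -/
def radialRetraction (R : ℝ) (x : W) : W := (R / max R ‖x‖) • x

lemma radialRetraction_of_norm_le {R : ℝ} (hR : 0 < R) {x : W} (hx : ‖x‖ ≤ R) :
    radialRetraction R x = x := by
  rw [radialRetraction, max_eq_left hx, div_self hR.ne', one_smul]

lemma norm_radialRetraction_le_norm {R : ℝ} (hR : 0 < R) (x : W) :
    ‖radialRetraction R x‖ ≤ ‖x‖ := by
  have ha : 0 < max R ‖x‖ := lt_max_of_lt_left hR
  rw [radialRetraction, norm_smul, Real.norm_of_nonneg (by positivity)]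
  exact mul_le_of_le_one_left (norm_nonneg x) ((div_le_one ha).2 (le_max_left _ _))

lemma norm_radialRetraction_le {R : ℝ} (hR : 0 < R) (x : W) :
    ‖radialRetraction R x‖ ≤ R := by
  have ha : 0 < max R ‖x‖ := lt_max_of_lt_left hR
  rw [radialRetraction, norm_smul, Real.norm_of_nonneg (by positivity), div_mul_eq_mul_div,
    div_le_iff₀ ha]
  exact mul_le_mul_of_nonneg_left (le_max_right _ _) hR.le

lemma lipschitzWith_radialRetraction {R : ℝ} (hR : 0 < R) :
    LipschitzWith 2 (radialRetraction R : W → W) := by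
  refine LipschitzWith.of_dist_le_mul fun x y => ?_
  rw [dist_eq_norm, dist_eq_norm]
  have ha : 0 < max R ‖x‖ := lt_max_of_lt_left hR
  have hb : 0 < max R ‖y‖ := lt_max_of_lt_left hR
  have hab : |max R ‖y‖ - max R ‖x‖| ≤ ‖x - y‖ := by
    refine (abs_max_sub_max_le_max R ‖y‖ R ‖x‖).trans ?_
    rw [sub_self, abs_zero, max_eq_right (abs_nonneg _), norm_sub_rev]
    exact abs_norm_sub_norm_le y x
  have hRa : R ≤ max R ‖x‖ := le_max_left _ _
  have hyb : ‖y‖ ≤ max R ‖y‖ := le_max_right _ _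
  unfold radialRetraction
  generalize max R ‖x‖ = a at *
  generalize max R ‖y‖ = b at *
  have hsplit : (R / a) • x - (R / b) • y = (R / a) • (x - y) + ((R / a) * ((b - a) / b)) • y := by
    have hcoeff : R / a * ((b - a) / b) = R / a - R / b := by field_simp
    rw [hcoeff, smul_sub, sub_smul]
    abel
  have hRa' : R / a ≤ 1 := (div_le_one ha).2 hRa
  have hRa0 : 0 ≤ R / a := by positivity
  rw [hsplit]
  refine (norm_add_le _ _).trans ?_
  rw [norm_smul, norm_smul, norm_mul, Real.norm_of_nonneg hRa0, norm_div,
    Real.norm_of_nonneg hb.le, Real.norm_eq_abs]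
  have h1 : R / a * ‖x - y‖ ≤ ‖x - y‖ := mul_le_of_le_one_left (norm_nonneg _) hRa'
  have h2 : R / a * (|b - a| / b) * ‖y‖ ≤ ‖x - y‖ := by
    calc R / a * (|b - a| / b) * ‖y‖ ≤ 1 * (|b - a| / b) * b := by gcongr
      _ = |b - a| := by field_simp
      _ ≤ ‖x - y‖ := hab
  have h3 : ((2 : NNReal) : ℝ) = 2 := rfl
  rw [h3]
  linarith

lemma hasDerivWithinAt_Ici_of_I01 {f : ℝ → W} {f' : W} {τ : ℝ} (hτ : τ ∈ Ico (0 : ℝ) 1)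
    (h : HasDerivWithinAt f f' I01 τ) : HasDerivWithinAt f f' (Ici τ) τ :=
  h.mono_of_mem_nhdsWithin
    (Filter.mem_of_superset (Icc_mem_nhdsGE hτ.2) (Icc_subset_Icc_left hτ.1))

lemma hasDerivWithinAt_Iic_of_I01 {f : ℝ → W} {f' : W} {τ : ℝ} (hτ : τ ∈ Ioc (0 : ℝ) 1)
    (h : HasDerivWithinAt f f' I01 τ) : HasDerivWithinAt f f' (Iic τ) τ :=
  h.mono_of_mem_nhdsWithin
    (Filter.mem_of_superset (Icc_mem_nhdsLE hτ.1) (Icc_subset_Icc_right hτ.2))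

lemma exists_nnnorm_le_on_I01 {B : ℝ → W →L[ℝ] W} (hB : ContinuousOn B I01) :
    ∃ K : NNReal, ∀ τ ∈ I01, ‖B τ‖₊ ≤ K := by
  obtain ⟨C, hC⟩ := isCompact_Icc.exists_bound_of_continuousOn hB
  exact ⟨C.toNNReal, fun τ hτ => NNReal.coe_le_coe.1 ((hC τ hτ).trans (Real.le_coe_toNNReal C))⟩

/-- Global existence on `[0,1]` for linear initial value problems. -/
lemma exists_linear_ode_solution [CompleteSpace W] {B : ℝ → W →L[ℝ] W} (hB : ContinuousOn B I01)
    (w : W) : ∃ f : ℝ → W, f 0 = w ∧ ∀ τ ∈ I01, HasDerivWithinAt f (-(B τ (f τ))) I01 τ := by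
  obtain ⟨K, hK⟩ := exists_nnnorm_le_on_I01 hB
  set R : NNReal := (‖w‖₊ + 1) * (Real.exp K).toNNReal with hRdef
  have hRcoe : (R : ℝ) = (‖w‖ + 1) * Real.exp K := by
    simp [hRdef, Real.exp_nonneg]
  have hR : (0 : ℝ) < R := by rw [hRcoe]; positivity
  have hlin : ∀ τ ∈ I01, LipschitzWith K fun x => -(B τ x) := fun τ hτ =>
    ((B τ).lipschitz.weaken (hK τ hτ)).neg
  have hnorm : ∀ τ ∈ I01, ∀ x, ‖-(B τ (radialRetraction R x))‖ ≤ K * ‖radialRetraction R x‖ := by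
    intro τ hτ x
    rw [norm_neg]
    exact (B τ).le_of_opNorm_le (NNReal.coe_le_coe.2 (hK τ hτ)) _
  have hPL : IsPicardLindelof (fun τ x => -(B τ (radialRetraction R x)))
      (⟨0, zero_mem_I01⟩ : Icc (0 : ℝ) 1) w (K * R) 0 (K * R) (K * 2) :=
    { lipschitzOnWith := fun τ hτ =>
        ((hlin τ hτ).comp (lipschitzWith_radialRetraction hR)).lipschitzOnWith
      continuousOn := fun x _ => (hB.clm_apply continuousOn_const).neg
      norm_le := fun τ hτ x _ => (hnorm τ hτ x).trans <| by
        push_cast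
        exact mul_le_mul_of_nonneg_left (norm_radialRetraction_le hR x) K.2
      mul_max_le := by simp }
  obtain ⟨f, hf0, hf⟩ := hPL.exists_eq_forall_mem_Icc_hasDerivWithinAt₀
  have hf0' : f 0 = w := hf0
  have hbound := norm_le_gronwallBound_of_norm_deriv_right_le (δ := ‖w‖) (K := K) (ε := 0)
    (fun τ hτ => (hf τ hτ).continuousWithinAt)
    (fun τ hτ => hasDerivWithinAt_Ici_of_I01 hτ (hf τ (Ico_subset_Icc_self hτ)))
    (by rw [hf0'])
    (fun τ hτ => by
      rw [add_zero]
      exact (hnorm τ (Ico_subset_Icc_self hτ) _).trans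
        (mul_le_mul_of_nonneg_left (norm_radialRetraction_le_norm hR _) K.2))
  refine ⟨f, hf0', fun τ hτ => ?_⟩
  have hfR : ‖f τ‖ ≤ R := by
    refine (hbound τ hτ).trans ?_
    rw [gronwallBound_ε0, sub_zero, hRcoe]
    have hKτ : (K : ℝ) * τ ≤ K := mul_le_of_le_one_right K.2 hτ.2
    gcongr
    linarith
  have := hf τ hτ
  rwa [radialRetraction_of_norm_le hR hfR] at this

/-- `C¹` solutions on `[0,1]` of the linear equation `ẋ + B x = 0`. -/
def IsLinearODESolution (B : ℝ → W →L[ℝ] W) (u : I01 → W) : Prop :=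
  ∃ f : ℝ → W, ContDiffOn ℝ 1 f I01 ∧ (∀ τ : I01, u τ = f ↑τ) ∧
    ∀ τ ∈ I01, dd f τ + B τ (f τ) = 0

lemma isLinearODESolution_iff {B : ℝ → W →L[ℝ] W} (hB : ContinuousOn B I01) {u : I01 → W} :
    IsLinearODESolution B u ↔ ∃ f : ℝ → W, (∀ τ : I01, u τ = f ↑τ) ∧
      ∀ τ ∈ I01, HasDerivWithinAt f (-(B τ (f τ))) I01 τ := by
  have huniq : UniqueDiffOn ℝ I01 := uniqueDiffOn_Icc zero_lt_one
  constructor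
  · rintro ⟨f, hf, hu, hode⟩
    refine ⟨f, hu, fun τ hτ => ?_⟩
    rw [← eq_neg_of_add_eq_zero_left (hode τ hτ)]
    exact (hf.differentiableOn one_ne_zero τ hτ).hasDerivWithinAt
  · rintro ⟨f, hu, hf⟩
    have hderiv : ∀ τ ∈ I01, derivWithin f I01 τ = -(B τ (f τ)) := fun τ hτ =>
      (hf τ hτ).derivWithin (huniq τ hτ)
    have hcont : ContinuousOn f I01 := fun τ hτ => (hf τ hτ).continuousWithinAt
    refine ⟨f, (contDiffOn_one_iff_derivWithin huniq).2
      ⟨fun τ hτ => (hf τ hτ).differentiableWithinAt, ?_⟩, hu, fun τ hτ => ?_⟩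
    · exact (hB.clm_apply hcont).neg.congr hderiv
    · rw [dd, hderiv τ hτ, neg_add_cancel]

namespace IsLinearODESolution

variable {B : ℝ → W →L[ℝ] W} {u v : I01 → W}

lemma add (hB : ContinuousOn B I01) (hu : IsLinearODESolution B u)
    (hv : IsLinearODESolution B v) : IsLinearODESolution B (u + v) := by
  rw [isLinearODESolution_iff hB] at *
  obtain ⟨f, huf, hf⟩ := hu
  obtain ⟨g, hvg, hg⟩ := hv
  refine ⟨f + g, fun τ => by simp [huf, hvg], fun τ hτ => ?_⟩
  convert! (hf τ hτ).add (hg τ hτ) using 1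
  simp [add_comm]

lemma const_smul (hB : ContinuousOn B I01) (c : ℝ) (hu : IsLinearODESolution B u) :
    IsLinearODESolution B (c • u) := by
  rw [isLinearODESolution_iff hB] at *
  obtain ⟨f, huf, hf⟩ := hu
  refine ⟨c • f, fun τ => by simp [huf], fun τ hτ => ?_⟩
  convert! (hf τ hτ).const_smul c using 1
  simp

lemma eq_of_eq_at_zero (hB : ContinuousOn B I01) (hu : IsLinearODESolution B u)
    (hv : IsLinearODESolution B v) (h : u ⟨0, zero_mem_I01⟩ = v ⟨0, zero_mem_I01⟩) : u = v := by
  rw [isLinearODESolution_iff hB] at *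
  obtain ⟨K, hK⟩ := exists_nnnorm_le_on_I01 hB
  obtain ⟨f, huf, hf⟩ := hu
  obtain ⟨g, hvg, hg⟩ := hv
  rw [huf, hvg] at h
  have heq : EqOn f g I01 := ODE_solution_unique_of_mem_Icc_right (s := fun _ => Set.univ)
    (v := fun τ x => -(B τ x))
    (fun τ hτ => ((B τ).lipschitz.weaken
      (hK τ (Ico_subset_Icc_self hτ))).neg.lipschitzOnWith)
    (fun τ hτ => (hf τ hτ).continuousWithinAt)
    (fun τ hτ => hasDerivWithinAt_Ici_of_I01 hτ (hf τ (Ico_subset_Icc_self hτ)))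
    (fun _ _ => trivial)
    (fun τ hτ => (hg τ hτ).continuousWithinAt)
    (fun τ hτ => hasDerivWithinAt_Ici_of_I01 hτ (hg τ (Ico_subset_Icc_self hτ)))
    (fun _ _ => trivial) h
  ext τ
  rw [huf, hvg, heq τ.2]

lemma eq_of_eq_at_one (hB : ContinuousOn B I01) (hu : IsLinearODESolution B u)
    (hv : IsLinearODESolution B v) (h : u ⟨1, one_mem_I01⟩ = v ⟨1, one_mem_I01⟩) : u = v := by
  rw [isLinearODESolution_iff hB] at *
  obtain ⟨K, hK⟩ := exists_nnnorm_le_on_I01 hB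
  obtain ⟨f, huf, hf⟩ := hu
  obtain ⟨g, hvg, hg⟩ := hv
  rw [huf, hvg] at h
  have heq : EqOn f g I01 := ODE_solution_unique_of_mem_Icc_left (s := fun _ => Set.univ)
    (v := fun τ x => -(B τ x))
    (fun τ hτ => ((B τ).lipschitz.weaken
      (hK τ (Ioc_subset_Icc_self hτ))).neg.lipschitzOnWith)
    (fun τ hτ => (hf τ hτ).continuousWithinAt)
    (fun τ hτ => hasDerivWithinAt_Iic_of_I01 hτ (hf τ (Ioc_subset_Icc_self hτ)))
    (fun _ _ => trivial)
    (fun τ hτ => (hg τ hτ).continuousWithinAt)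
    (fun τ hτ => hasDerivWithinAt_Iic_of_I01 hτ (hg τ (Ioc_subset_Icc_self hτ)))
    (fun _ _ => trivial) h
  ext τ
  rw [huf, hvg, heq τ.2]

end IsLinearODESolution

/-- The solution operator of `ẋ + B x = 0`, sending an initial value to the solution. -/
lemma exists_linear_ode_solution_operator [CompleteSpace W] {B : ℝ → W →L[ℝ] W}
    (hB : ContinuousOn B I01) :
    ∃ Φ : W →ₗ[ℝ] (I01 → W), ∀ w, IsLinearODESolution B (Φ w) ∧ Φ w ⟨0, zero_mem_I01⟩ = w := by
  have hex : ∀ w : W, ∃ u : I01 → W, IsLinearODESolution B u ∧ u ⟨0, zero_mem_I01⟩ = w := by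
    intro w
    obtain ⟨f, hf0, hf⟩ := exists_linear_ode_solution hB w
    exact ⟨fun τ => f τ, (isLinearODESolution_iff hB).2 ⟨f, fun _ => rfl, hf⟩, hf0⟩
  choose Φ hΦ hΦ0 using hex
  refine ⟨{ toFun := Φ, map_add' := fun x y => ?_, map_smul' := fun c x => ?_ },
    fun w => ⟨hΦ w, hΦ0 w⟩⟩
  · exact (hΦ _).eq_of_eq_at_zero hB ((hΦ x).add hB (hΦ y))
      (by simp only [Pi.add_apply, hΦ0])
  · exact (hΦ _).eq_of_eq_at_zero hB ((hΦ x).const_smul hB c)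
      (by simp only [Pi.smul_apply, hΦ0, RingHom.id_apply])

end LinearODE

section Kirchhoff

variable {V E W : Type*} [Fintype E] [DecidableEq V]
  [AddCommGroup W] [Module ℝ W]

/-- The Kirchhoff defect at the interior vertices of a tuple of initial values on the edges, when
the value at the end of the edge `e` is obtained by applying `A e` to the initial value. -/
def kirchhoffDefect (s t : E → V) (A : E → W →ₗ[ℝ] W) :
    (E → W) →ₗ[ℝ] ({v : V // IsInteriorVtx s t v} → W) :=
  LinearMap.pi fun v =>
    (∑ e ∈ Finset.univ.filter (fun e => s e = v.1), LinearMap.proj e) -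
      ∑ e ∈ Finset.univ.filter (fun e => t e = v.1), A e ∘ₗ LinearMap.proj e

lemma kirchhoffDefect_apply (s t : E → V) (A : E → W →ₗ[ℝ] W) (c : E → W)
    (v : {v : V // IsInteriorVtx s t v}) :
    kirchhoffDefect s t A c v = (∑ e ∈ Finset.univ.filter (fun e => s e = v.1), c e) -
      ∑ e ∈ Finset.univ.filter (fun e => t e = v.1), A e (c e) := by
  simp [kirchhoffDefect]

/-- The vector `w` placed at the vertex `v`, restricted to the interior vertices. -/
def interiorSingle (s t : E → V) (v : V) (w : W) : {v : V // IsInteriorVtx s t v} → W :=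
  fun v' => if v = v'.1 then w else 0

lemma kirchhoffDefect_single [DecidableEq E] (s t : E → V) (A : E → W →ₗ[ℝ] W) (e : E) (w : W) :
    kirchhoffDefect s t A (Pi.single e w) =
      interiorSingle s t (s e) w - interiorSingle s t (t e) (A e w) := by
  ext v
  have hA : ∀ e', A e' ((Pi.single e w : E → W) e') = (Pi.single e (A e w) : E → W) e' := by
    intro e'
    rcases eq_or_ne e' e with rfl | h
    · simp
    · simp [h]
  simp [kirchhoffDefect_apply, interiorSingle, hA]

lemma kirchhoffDefect_surjective [Fintype V] {s t : E → V} (hconn : QConnected s t)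
    (hbd : ∃ v : V, IsBoundaryVtx s t v) {A : E → W →ₗ[ℝ] W}
    (hA : ∀ e, Function.Surjective (A e)) : Function.Surjective (kirchhoffDefect s t A) := by
  classical
  set R := LinearMap.range (kirchhoffDefect s t A) with hR
  have hedge : ∀ e w, interiorSingle s t (s e) w - interiorSingle s t (t e) (A e w) ∈ R :=
    fun e w => ⟨Pi.single e w, kirchhoffDefect_single s t A e w⟩
  have hvtx : ∀ v w, interiorSingle s t v w ∈ R := by
    obtain ⟨b, hb⟩ := hbd
    intro v
    induction hconn b v with
    | refl =>
      intro w
      have hzero : interiorSingle s t b w = 0 := by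
        ext v'
        exact if_neg fun (h : b = v'.1) => v'.2 (h ▸ hb)
      rw [hzero]
      exact R.zero_mem
    | tail _ hstep ih =>
      intro w
      obtain ⟨e, ⟨rfl, rfl⟩ | ⟨rfl, rfl⟩⟩ := hstep
      · obtain ⟨w, rfl⟩ := hA e w
        exact (R.sub_mem_iff_right (ih w)).1 (hedge e w)
      · exact (R.sub_mem_iff_left (ih (A e w))).1 (hedge e w)
  intro y
  have hy : y = ∑ v : {v : V // IsInteriorVtx s t v}, interiorSingle s t v.1 (y v) := by
    ext v
    simp [interiorSingle, Finset.sum_apply, Subtype.coe_inj]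
  rw [← LinearMap.mem_range, ← hR, hy]
  exact R.sum_mem fun v _ => hvtx v.1 (y v)

lemma finrank_ker_kirchhoffDefect [Fintype V] [FiniteDimensional ℝ W] {s t : E → V}
    (hconn : QConnected s t)  (hbd : ∃ v : V, IsBoundaryVtx s t v) {A : E → W →ₗ[ℝ] W}
    (hA : ∀ e, Function.Surjective (A e)) :
    Module.finrank ℝ (LinearMap.ker (kirchhoffDefect s t A)) =
      (Fintype.card E - (Finset.univ.filter (fun v => IsInteriorVtx s t v)).card)
        * Module.finrank ℝ W := by
  have h := (kirchhoffDefect s t A).finrank_range_add_finrank_ker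
  rw [LinearMap.range_eq_top.2 (kirchhoffDefect_surjective hconn hbd hA), finrank_top,
    Module.finrank_pi_fintype, Module.finrank_pi_fintype] at h
  simp only [Finset.sum_const, Finset.card_univ, smul_eq_mul, Fintype.card_subtype] at h
  rw [Nat.sub_mul]
  omega

end Kirchhoff

/-- The space of `C¹` solutions of the homogeneous linear ODEs
`ẋ_e + B_e x_e = 0` satisfying the Kirchhoff law at all interior vertices is a real
vector space of dimension `(|E| - |Γ_int|) · dim W`.  Solutions are recorded as
functions on the interval `[0,1]` (i.e. on the subtype `↥I01`). -/
theorem laxKirchhoff_linear_solution_space_finrank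
    {V E : Type} [Fintype V] [Fintype E] [DecidableEq V]
    (s t : E → V) (hiso : NoIsolated s t) (hconn : QConnected s t)
    (hbd : ∃ v : V, IsBoundaryVtx s t v)
    {W : Type} [NormedAddCommGroup W] [NormedSpace ℝ W] [FiniteDimensional ℝ W]
    (B : E → ℝ → (W →L[ℝ] W)) (hB : ∀ e, ContinuousOn (B e) I01) :
    ∃ S : Submodule ℝ (E → (I01 → W)),
      (S : Set (E → (I01 → W))) =
        {u | (∀ e, ∃ f : ℝ → W, ContDiffOn ℝ 1 f I01 ∧ (∀ τ : I01, u e τ = f ↑τ) ∧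
                ∀ τ ∈ I01, dd f τ + B e τ (f τ) = 0) ∧
             (∀ v, IsInteriorVtx s t v →
                (∑ e ∈ Finset.univ.filter (fun e => s e = v), u e ⟨0, zero_mem_I01⟩)
                  = ∑ e ∈ Finset.univ.filter (fun e => t e = v), u e ⟨1, one_mem_I01⟩)} ∧
      Module.finrank ℝ S =
        (Fintype.card E
            - (Finset.univ.filter (fun v => IsInteriorVtx s t v)).card)
          * Module.finrank ℝ W := by
  have : CompleteSpace W := FiniteDimensional.complete ℝ W
  choose Φ hΦ using fun e => exists_linear_ode_solution_operator (hB e)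
  let A : E → W →ₗ[ℝ] W := fun e => LinearMap.proj ⟨1, one_mem_I01⟩ ∘ₗ Φ e
  have hA : ∀ e, Function.Surjective (A e) := by
    refine fun e => LinearMap.surjective_of_injective fun x y hxy => ?_
    rw [← (hΦ e x).2, (hΦ e x).1.eq_of_eq_at_one (hB e) (hΦ e y).1 hxy, (hΦ e y).2]
  let Ψ : (E → W) →ₗ[ℝ] (E → (I01 → W)) := LinearMap.pi fun e => Φ e ∘ₗ LinearMap.proj e
  have hΨ : Function.Injective Ψ := fun c d hcd => funext fun e => by
    rw [← (hΦ e (c e)).2, ← (hΦ e (d e)).2]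
    exact congrFun (congrFun hcd e) _
  refine ⟨(LinearMap.ker (kirchhoffDefect s t A)).map Ψ, ?_, ?_⟩
  · ext u
    simp only [SetLike.mem_coe, Submodule.mem_map, LinearMap.mem_ker, Set.mem_ofPred_eq]
    constructor
    · rintro ⟨c, hc, rfl⟩
      refine ⟨fun e => (hΦ e (c e)).1, fun v hv => ?_⟩
      have hcv := congrFun hc ⟨v, hv⟩
      rw [kirchhoffDefect_apply] at hcv
      exact (Finset.sum_congr rfl fun e _ => (hΦ e (c e)).2).trans (sub_eq_zero.1 hcv)
    · rintro ⟨hu, hK⟩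
      have hΦu : ∀ e, Φ e (u e ⟨0, zero_mem_I01⟩) = u e := fun e =>
        (hΦ e _).1.eq_of_eq_at_zero (hB e) (hu e) (hΦ e _).2
      refine ⟨fun e => u e ⟨0, zero_mem_I01⟩, funext fun v => ?_, funext hΦu⟩
      rw [kirchhoffDefect_apply, hK v.1 v.2]
      exact sub_eq_zero.2 (Finset.sum_congr rfl fun e _ => (congrFun (hΦu e) _).symm)
  · rw [← (Submodule.equivMapOfInjective Ψ hΨ _).finrank_eq]
    exact finrank_ker_kirchhoffDefect hconn hbd hA
end
end

section
/- Let Γ = (V, E, s, t) be a connected quiver with non-empty boundary and let W be a finite-dimensional real vector space. Then for every tuple v = (v_e)_{e∈E} of continuous functions v_e : [0,1] → W and every family y = (y_w)_{w∈Γ_int} in W, there exists a unique tuple u = (u_e)_{e∈E} of C² functions u_e : [0,1] → W such that: (i) there exist elements u(w) ∈ W (w ∈ V) with u_e(0) = u(s(e)) and u_e(1) = u(t(e)) for all e ∈ E, and u(w) = 0 for all w ∈ ∂Γ; (ii) −ü_e = v_e on [0,1] for every e ∈ E; and (iii) ∑_{e∈s⁻¹(w)} u̇_e(0) − ∑_{e∈t⁻¹(w)}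 u̇_e(1) = y_w for every interior vertex w ∈ Γ_int. (The operator L₀ is an isomorphism.) -/
open Set Finset

noncomputable section

section Interval

variable {W : Type*} [NormedAddCommGroup W] [NormedSpace ℝ W]

lemma dd_eq_of_hasDerivAt {f : ℝ → W} {f' : W} {τ : ℝ} (hτ : τ ∈ I01)
    (h : HasDerivAt f f' τ) : dd f τ = f' :=
  h.hasDerivWithinAt.derivWithin (uniqueDiffOn_Icc zero_lt_one τ hτ)

lemma dd_congr {f g : ℝ → W} (h : ∀ τ ∈ I01, f τ = g τ) {τ : ℝ} (hτ : τ ∈ I01) :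
    dd f τ = dd g τ :=
  derivWithin_congr h (h τ hτ)

lemma dd_sub {f g : ℝ → W} {τ : ℝ} (hf : DifferentiableWithinAt ℝ f I01 τ)
    (hg : DifferentiableWithinAt ℝ g I01 τ) :
    dd (fun σ => f σ - g σ) τ = dd f τ - dd g τ :=
  derivWithin_fun_sub hf hg

lemma ContDiffOn.differentiableOn_dd {f : ℝ → W} (hf : ContDiffOn ℝ 2 f I01) :
    DifferentiableOn ℝ (dd f) I01 :=
  (hf.derivWithin (m := 1) (uniqueDiffOn_Icc zero_lt_one) (by norm_num)).differentiableOn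
    one_ne_zero

lemma dd_dd_sub {f g : ℝ → W} (hf : ContDiffOn ℝ 2 f I01) (hg : ContDiffOn ℝ 2 g I01)
    {τ : ℝ} (hτ : τ ∈ I01) :
    dd (dd fun σ => f σ - g σ) τ = dd (dd f) τ - dd (dd g) τ := by
  rw [← dd_sub (hf.differentiableOn_dd τ hτ) (hg.differentiableOn_dd τ hτ)]
  exact dd_congr (fun σ hσ => dd_sub (hf.differentiableOn two_ne_zero σ hσ)
    (hg.differentiableOn two_ne_zero σ hσ)) hτ

/-- A `C²` function on `[0,1]` with vanishing second derivative is affine. -/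
lemma affine_of_dd_dd_eq_zero {f : ℝ → W} (hf : ContDiffOn ℝ 2 f I01)
    (h : ∀ τ ∈ I01, dd (dd f) τ = 0) :
    (∀ τ ∈ I01, dd f τ = f 1 - f 0) ∧ ∀ τ ∈ I01, f τ = f 0 + τ • (f 1 - f 0) := by
  have hconst : ∀ τ ∈ I01, dd f τ = dd f 0 :=
    constant_of_derivWithin_zero hf.differentiableOn_dd
      fun τ hτ => h τ (Ico_subset_Icc_self hτ)
  have hline : ∀ τ : ℝ, HasDerivAt (fun σ : ℝ => σ • dd f 0) (dd f 0) τ := fun τ => by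
    simpa using (hasDerivAt_id τ).smul_const (dd f 0)
  have hdf := hf.differentiableOn two_ne_zero
  have haff : ∀ τ ∈ I01, f τ - τ • dd f 0 = f 0 - (0 : ℝ) • dd f 0 :=
    constant_of_derivWithin_zero
      (hdf.sub fun τ _ => (hline τ).differentiableAt.differentiableWithinAt)
      fun τ hτ => by
        have hτ' := Ico_subset_Icc_self hτ
        change dd (fun σ => f σ - σ • dd f 0) τ = 0
        rw [dd_sub (hdf τ hτ') (hline τ).differentiableAt.differentiableWithinAt,
          dd_eq_of_hasDerivAt hτ' (hline τ), hconst τ hτ', sub_self]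
  have hslope : dd f 0 = f 1 - f 0 := by
    have h1 := haff 1 one_mem_I01
    rw [one_smul, zero_smul, sub_zero] at h1
    rw [← h1, sub_sub_cancel]
  refine ⟨fun τ hτ => (hconst τ hτ).trans hslope, fun τ hτ => ?_⟩
  have h1 := haff τ hτ
  rw [zero_smul, sub_zero, hslope] at h1
  rw [← sub_eq_iff_eq_add]
  exact h1

/-- The negative of a function continuous on `[0,1]` has a second antiderivative there with
vanishing initial value and initial slope. -/
lemma exists_neg_second_antiderivative [CompleteSpace W] {v : ℝ → W}
    (hv : ContinuousOn v I01) :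
    ∃ P Q : ℝ → W, ContDiff ℝ 2 P ∧ P 0 = 0 ∧ Q 0 = 0 ∧
      (∀ τ, HasDerivAt P (Q τ) τ) ∧ ∀ τ ∈ I01, HasDerivAt Q (-v τ) τ := by
  set g : ℝ → W := IccExtend (zero_le_one (α := ℝ)) (I01.domRestrict v)
  have hgc : Continuous g := hv.domRestrict.Icc_extend'
  set Q : ℝ → W := fun τ => -∫ σ in (0 : ℝ)..τ, g σ with hQ
  have hQd : ∀ τ, HasDerivAt Q (-g τ) τ := fun τ =>
    (hgc.integral_hasStrictDerivAt 0 τ).hasDerivAt.neg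
  have hQc : Continuous Q := continuous_iff_continuousAt.2 fun τ => (hQd τ).continuousAt
  set P : ℝ → W := fun τ => ∫ σ in (0 : ℝ)..τ, Q σ with hP
  have hPd : ∀ τ, HasDerivAt P (Q τ) τ := fun τ =>
    (hQc.integral_hasStrictDerivAt 0 τ).hasDerivAt
  have hQ1 : ContDiff ℝ 1 Q := by
    rw [contDiff_one_iff_deriv]
    refine ⟨fun τ => (hQd τ).differentiableAt, ?_⟩
    rw [funext fun τ => (hQd τ).deriv]
    exact hgc.neg
  have hP2 : ContDiff ℝ (1 + 1) P := by
    rw [contDiff_succ_iff_deriv]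
    refine ⟨fun τ => (hPd τ).differentiableAt, by simp, ?_⟩
    rwa [funext fun τ => (hPd τ).deriv]
  refine ⟨P, Q, by simpa [one_add_one_eq_two] using hP2, by simp [hP], by simp [hQ], hPd,
    fun τ hτ => ?_⟩
  have h1 : g τ = v τ := IccExtend_of_mem zero_le_one _ hτ
  exact h1 ▸ hQd τ

end Interval

section Laplacian

variable {V E : Type*} [Fintype V] [Fintype E] [DecidableEq V]

/-- The outflow minus the inflow at `w` of an edge function. -/
def kirchhoff {W : Type*} [AddCommGroup W] (s t : E → V) (c : E → W) (w : V) : W :=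
  (∑ e ∈ Finset.univ.filter (fun e => s e = w), c e)
    - ∑ e ∈ Finset.univ.filter (fun e => t e = w), c e

/-- Summation by parts on a quiver. -/
lemma sum_mul_kirchhoff (s t : E → V) (c : E → ℝ) (φ : V → ℝ) :
    ∑ w, φ w * kirchhoff s t c w = -∑ e, (φ (t e) - φ (s e)) * c e := by
  have key : ∀ p : E → V,
      ∑ w, φ w * ∑ e ∈ Finset.univ.filter (fun e => p e = w), c e = ∑ e, φ (p e) * c e := by
    intro p
    rw [← Finset.sum_fiberwise Finset.univ p]
    refine Finset.sum_congr rfl fun w _ => ?_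
    rw [Finset.mul_sum]
    refine Finset.sum_congr rfl fun e he => ?_
    rw [(Finset.mem_filter.1 he).2]
  simp only [kirchhoff, mul_sub, Finset.sum_sub_distrib, key, sub_mul]
  ring

/-- A harmonic function vanishing on the non-empty boundary of a connected quiver is zero. -/
lemma eq_zero_of_harmonic {s t : E → V} (hconn : QConnected s t)
    (hbd : ∃ v : V, IsBoundaryVtx s t v) {φ : V → ℝ}
    (h0 : ∀ w, IsBoundaryVtx s t w → φ w = 0)
    (hh : ∀ w, IsInteriorVtx s t w → kirchhoff s t (fun e => φ (t e) - φ (s e)) w = 0) :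
    φ = 0 := by
  have hsum : ∑ e, (φ (t e) - φ (s e)) * (φ (t e) - φ (s e)) = 0 := by
    rw [← neg_eq_zero, ← sum_mul_kirchhoff]
    refine Finset.sum_eq_zero fun w _ => ?_
    by_cases hw : IsBoundaryVtx s t w
    · rw [h0 w hw, zero_mul]
    · rw [hh w hw, mul_zero]
  have hedge : ∀ e, φ (t e) = φ (s e) := fun e => by
    have := (Finset.sum_eq_zero_iff_of_nonneg fun e _ => mul_self_nonneg _).1 hsum e
      (Finset.mem_univ e)
    exact sub_eq_zero.1 (mul_self_eq_zero.1 this)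
  obtain ⟨b, hb⟩ := hbd
  funext w
  have hpath := hconn b w
  induction hpath with
  | refl => exact h0 b hb
  | tail _ hstep ih =>
    obtain ⟨e, ⟨hs, ht⟩ | ⟨hs, ht⟩⟩ := hstep
    · rw [← ht, hedge e, hs, ih]; rfl
    · rw [← hs, ← hedge e, ht, ih]; rfl

variable {W : Type*} [AddCommGroup W] [Module ℝ W]

lemma eq_zero_of_vector_harmonic {s t : E → V} (hconn : QConnected s t)
    (hbd : ∃ v : V, IsBoundaryVtx s t v) {x : V → W}
    (h0 : ∀ w, IsBoundaryVtx s t w → x w = 0)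
    (hh : ∀ w, IsInteriorVtx s t w → kirchhoff s t (fun e => x (t e) - x (s e)) w = 0) :
    x = 0 := by
  funext w
  refine (Module.forall_dual_apply_eq_zero_iff ℝ (x w)).1 fun f => ?_
  refine congrFun (eq_zero_of_harmonic hconn hbd (φ := fun w => f (x w)) ?_ ?_) w
  · intro w hw
    rw [h0 w hw, map_zero]
  · intro w hw
    simpa [kirchhoff] using congrArg f (hh w hw)

/-- The discrete Laplacian with Dirichlet boundary values. -/
def dirichletLaplacian (W : Type*) [AddCommGroup W] [Module ℝ W] (s t : E → V) :
    (V → W) →ₗ[ℝ] (V → W) where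
  toFun x w := if IsBoundaryVtx s t w then x w else kirchhoff s t (fun e => x (t e) - x (s e)) w
  map_add' x z := by
    funext w
    by_cases hw : IsBoundaryVtx s t w
    · simp [hw]
    · simp only [hw, if_false, kirchhoff, Pi.add_apply, add_sub_add_comm,
        Finset.sum_add_distrib]
  map_smul' r x := by
    funext w
    by_cases hw : IsBoundaryVtx s t w
    · simp [hw]
    · simp only [hw, if_false, kirchhoff, Pi.smul_apply, RingHom.id_apply, ← smul_sub,
        ← Finset.smul_sum]

lemma exists_dirichlet_solution [FiniteDimensional ℝ W] {s t : E → V}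
    (hconn : QConnected s t) (hbd : ∃ v : V, IsBoundaryVtx s t v) (y : V → W) :
    ∃ x : V → W, (∀ w, IsBoundaryVtx s t w → x w = 0) ∧
      ∀ w, IsInteriorVtx s t w → kirchhoff s t (fun e => x (t e) - x (s e)) w = y w := by
  have hinj : Function.Injective (dirichletLaplacian W s t) := by
    rw [injective_iff_map_eq_zero]
    intro x hx
    refine eq_zero_of_vector_harmonic hconn hbd (fun w hw => ?_) fun w hw => ?_
    · exact (if_pos hw).symm.trans (congrFun hx w)
    · exact (if_neg hw).symm.trans (congrFun hx w)
  obtain ⟨x, hx⟩ := LinearMap.injective_iff_surjective.1 hinj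
    fun w => if IsBoundaryVtx s t w then 0 else y w
  refine ⟨x, fun w hw => ?_, fun w hw => ?_⟩
  · exact ((if_pos hw).symm.trans (congrFun hx w)).trans (if_pos hw)
  · exact ((if_neg hw).symm.trans (congrFun hx w)).trans (if_neg hw)

end Laplacian

/-- The model operator `L₀` is an isomorphism: for every continuous
`v = (v_e)` and every `y = (y_w)` at the interior vertices, there is a unique
`u ∈ C²₀(Γ, W)` with `−ü_e = v_e` on `[0,1]` and prescribed Kirchhoff defects of `u̇`
at the interior vertices.  Uniqueness is equality on `[0,1]`. -/
theorem L0_isomorphism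
    {V E : Type} [Fintype V] [Fintype E] [DecidableEq V]
    (s t : E → V) (hiso : NoIsolated s t) (hconn : QConnected s t)
    (hbd : ∃ v : V, IsBoundaryVtx s t v)
    {W : Type} [NormedAddCommGroup W] [NormedSpace ℝ W] [FiniteDimensional ℝ W]
    (v : E → ℝ → W) (hv : ∀ e, ContinuousOn (v e) I01)
    (y : V → W) :
    ∃ (u : E → ℝ → W) (uvtx : V → W),
      ((∀ e, ContDiffOn ℝ 2 (u e) I01) ∧
       (∀ e, u e 0 = uvtx (s e)) ∧ (∀ e, u e 1 = uvtx (t e)) ∧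
       (∀ w, IsBoundaryVtx s t w → uvtx w = 0) ∧
       (∀ e, ∀ τ ∈ I01, -(dd (dd (u e)) τ) = v e τ) ∧
       (∀ w, IsInteriorVtx s t w →
         (∑ e ∈ Finset.univ.filter (fun e => s e = w), dd (u e) 0)
           - (∑ e ∈ Finset.univ.filter (fun e => t e = w), dd (u e) 1) = y w)) ∧
      (∀ (u' : E → ℝ → W) (uvtx' : V → W),
        ((∀ e, ContDiffOn ℝ 2 (u' e) I01) ∧
         (∀ e, u' e 0 = uvtx' (s e)) ∧ (∀ e, u' e 1 = uvtx' (t e)) ∧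
         (∀ w, IsBoundaryVtx s t w → uvtx' w = 0) ∧
         (∀ e, ∀ τ ∈ I01, -(dd (dd (u' e)) τ) = v e τ) ∧
         (∀ w, IsInteriorVtx s t w →
           (∑ e ∈ Finset.univ.filter (fun e => s e = w), dd (u' e) 0)
             - (∑ e ∈ Finset.univ.filter (fun e => t e = w), dd (u' e) 1) = y w)) →
        ∀ e, ∀ τ ∈ I01, u' e τ = u e τ) := by
  have : CompleteSpace W := FiniteDimensional.complete ℝ W
  choose P Q hP2 hP0 hQ0 hPd hQd using fun e => exists_neg_second_antiderivative (hv e)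
  obtain ⟨x, hx0, hx⟩ := exists_dirichlet_solution hconn hbd fun w => y w
    + ((∑ e ∈ Finset.univ.filter (fun e => s e = w), P e 1)
      + ∑ e ∈ Finset.univ.filter (fun e => t e = w), (Q e 1 - P e 1))
  set b : E → W := fun e => x (t e) - x (s e) - P e 1 with hb
  set u : E → ℝ → W := fun e τ => x (s e) + τ • b e + P e τ with hu
  have hus : ∀ e, u e 0 = x (s e) := fun e => by simp [hu, hP0]
  have hut : ∀ e, u e 1 = x (t e) := fun e => by
    simp only [hu, hb, one_smul]
    abel
  have hud : ∀ e τ, HasDerivAt (u e) (b e + Q e τ) τ := fun e τ => by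
    have hline := ((hasDerivAt_id τ).smul_const (b e)).const_add (x (s e))
    rw [one_smul] at hline
    exact hline.add (hPd e τ)
  have hu2 : ∀ e, ContDiffOn ℝ 2 (u e) I01 := fun e =>
    ((contDiff_const.add (contDiff_id.smul contDiff_const)).add (hP2 e)).contDiffOn
  have hudd : ∀ e, ∀ τ ∈ I01, -(dd (dd (u e)) τ) = v e τ := fun e τ hτ => by
    rw [dd_congr (fun σ hσ => dd_eq_of_hasDerivAt hσ (hud e σ)) hτ,
      dd_eq_of_hasDerivAt hτ ((hQd e τ hτ).const_add (b e)), neg_neg]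
  have hukir : ∀ w, IsInteriorVtx s t w →
      (∑ e ∈ Finset.univ.filter (fun e => s e = w), dd (u e) 0)
        - (∑ e ∈ Finset.univ.filter (fun e => t e = w), dd (u e) 1) = y w := fun w hw => by
    have hxw := hx w hw
    simp only [kirchhoff, Finset.sum_sub_distrib] at hxw
    simp only [dd_eq_of_hasDerivAt zero_mem_I01 (hud _ 0),
      dd_eq_of_hasDerivAt one_mem_I01 (hud _ 1), hQ0]
    simp only [hb, add_zero, Finset.sum_add_distrib, Finset.sum_sub_distrib]
    rw [eq_sub_of_add_eq hxw.symm]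
    abel
  refine ⟨u, x, ⟨hu2, hus, hut, hx0, hudd, hukir⟩, ?_⟩
  rintro u' x' ⟨hu2', hus', hut', hx0', hudd', hukir'⟩ e τ hτ
  have haff := fun e => affine_of_dd_dd_eq_zero (f := fun σ => u' e σ - u e σ)
    ((hu2' e).sub (hu2 e)) fun σ hσ => by
      rw [dd_dd_sub (hu2' e) (hu2 e) hσ, sub_eq_zero, ← neg_inj, hudd' e σ hσ, hudd e σ hσ]
  have hslope : ∀ e, ∀ σ ∈ I01,
      dd (u' e) σ - dd (u e) σ = (x' - x) (t e) - (x' - x) (s e) := fun e σ hσ => by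
    rw [← dd_sub ((hu2' e).differentiableOn two_ne_zero σ hσ)
      ((hu2 e).differentiableOn two_ne_zero σ hσ), (haff e).1 σ hσ, hus, hut, hus', hut']
    rfl
  have hzero : x' - x = 0 := by
    refine eq_zero_of_vector_harmonic hconn hbd (fun w hw => ?_) fun w hw => ?_
    · rw [Pi.sub_apply, hx0 w hw, hx0' w hw, sub_zero]
    · rw [← sub_self (y w)]
      nth_rw 1 [← hukir' w hw]
      rw [← hukir w hw, sub_sub_sub_comm, ← Finset.sum_sub_distrib, ← Finset.sum_sub_distrib]
      simp only [kirchhoff, hslope _ 0 zero_mem_I01, hslope _ 1 one_mem_I01]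
  have hfin := (haff e).2 τ hτ
  simp only [hus, hut, hus', hut', sub_eq_zero.1 hzero, sub_self, smul_zero, add_zero] at hfin
  exact sub_eq_zero.1 hfin
end
end
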